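/- arXiv:2105.02014 — 2 statements merged into one kernel-verified Lean document; each statement's English description precedes it below -/
import Mathlib

section
/- Let A, B, C ∈ ℝ² be affinely independent. Let N and ρ be the circumcenter and circumradius of the medial triangle of ABC (the triangle with vertices (A+B)/2, (B+C)/2, (C+A)/2), let I and r be the incenter and inradius of ABC, and let I_A, I_B, I_C and r_A, r_B, r_C be the three excenters and exradii. Then dist(N, I) = ρ − r and dist(N, I_A) = ρ + r_A, dist(N, I_B) = ρ + r_B, dist(N, I_C) = ρ + r_C; that is, the nine-point circle is internally tangent to the incircle and externally tangent to each of the three excircles (Feuerbach's theorem). -/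
/-- The Euclidean plane. -/
abbrev Plane := EuclideanSpace ℝ (Fin 2)

/-- Twice the signed area of the triangle `XYZ`. -/
def signedArea (X Y Z : Plane) : ℝ :=
  (Y 0 - X 0) * (Z 1 - X 1) - (Y 1 - X 1) * (Z 0 - X 0)

lemma signedArea_rotate (X Y Z : Plane) : signedArea Y Z X = signedArea X Y Z := by
  unfold signedArea; ring

lemma dist_sq_eq_coords (X Y : Plane) : dist X Y ^ 2 = (X 0 - Y 0) ^ 2 + (X 1 - Y 1) ^ 2 := by
  rw [EuclideanSpace.dist_sq_eq, Fin.sum_univ_two, Real.dist_eq, Real.dist_eq, sq_abs, sq_abs]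

lemma infDist_line_mul_dist (P X Y : Plane) :
    Metric.infDist P (line[ℝ, X, Y] : Set Plane) * dist X Y = |signedArea X Y P| := by
  rcases eq_or_ne X Y with rfl | h
  · simp [signedArea]
  have hd : 0 < dist X Y := dist_pos.2 h
  have hd2 := dist_sq_eq_coords X Y
  apply le_antisymm
  · set t : ℝ := ((P 0 - X 0) * (Y 0 - X 0) + (P 1 - X 1) * (Y 1 - X 1)) / dist X Y ^ 2 with ht
    have ht' : t * dist X Y ^ 2 = (P 0 - X 0) * (Y 0 - X 0) + (P 1 - X 1) * (Y 1 - X 1) := by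
      rw [ht]; field_simp
    have hle := Metric.infDist_le_dist_of_mem (x := P)
      (AffineMap.lineMap_mem_affineSpan_pair t X Y)
    refine (mul_le_mul_of_nonneg_right hle hd.le).trans (le_of_eq ?_)
    rw [← abs_of_nonneg (mul_nonneg dist_nonneg hd.le), ← sq_eq_sq_iff_abs_eq_abs, mul_pow,
      dist_sq_eq_coords P]
    simp only [AffineMap.lineMap_apply, vsub_eq_sub, vadd_eq_add, PiLp.add_apply,
      PiLp.smul_apply, PiLp.sub_apply, smul_eq_mul, signedArea]
    rw [hd2] at ht' ⊢
    linear_combination (t * ((X 0 - Y 0) ^ 2 + (X 1 - Y 1) ^ 2) -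
      ((P 0 - X 0) * (Y 0 - X 0) + (P 1 - X 1) * (Y 1 - X 1))) * ht'
  · rw [← div_le_iff₀ hd]
    refine (Metric.le_infDist ⟨X, left_mem_affineSpan_pair ℝ X Y⟩).2 fun Q hQ => ?_
    obtain ⟨t, rfl⟩ := mem_affineSpan_pair_iff_exists_lineMap_eq.1 hQ
    rw [div_le_iff₀ hd]
    refine abs_le_of_sq_le_sq ?_ (by positivity)
    rw [mul_pow, dist_sq_eq_coords P, hd2]
    simp only [AffineMap.lineMap_apply, vsub_eq_sub, vadd_eq_add, PiLp.add_apply,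
      PiLp.smul_apply, PiLp.sub_apply, smul_eq_mul, signedArea]
    nlinarith [sq_nonneg ((P 0 - (t * (Y 0 - X 0) + X 0)) * (Y 0 - X 0) +
      (P 1 - (t * (Y 1 - X 1) + X 1)) * (Y 1 - X 1))]

lemma signedArea_ne_zero_of_affineIndependent {A B C : Plane}
    (h : AffineIndependent ℝ ![A, B, C]) : signedArea A B C ≠ 0 := by
  intro h0
  have hw (P : Plane) : signedArea B C P = 0 := by
    refine affineIndependent_iff.1 h Finset.univ
      ![signedArea B C P, signedArea C A P, signedArea A B P] ?_ ?_ 0 (Finset.mem_univ _)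
    · simp only [Fin.sum_univ_three, Matrix.cons_val, signedArea] at h0 ⊢
      linear_combination h0
    · simp only [signedArea] at h0
      ext i
      fin_cases i <;> simp [Fin.sum_univ_three, signedArea]
      · linear_combination P 0 * h0
      · linear_combination P 1 * h0
  refine h.injective.ne (show (1 : Fin 3) ≠ 2 by decide) ?_
  have h1 := hw !₂[B 0, B 1 + 1]
  have h2 := hw !₂[B 0 + 1, B 1]
  simp [signedArea] at h1 h2
  ext i
  fin_cases i <;> simp <;> linarith

lemma signedArea_mul_neg_of_sOppSide {X Y P Q : Plane} (h : (line[ℝ, X, Y]).SOppSide P Q)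
    (hQ : signedArea X Y Q ≠ 0) : signedArea X Y P * signedArea X Y Q < 0 := by
  obtain ⟨Z, hZ, ⟨t, ⟨ht0, ht1⟩, rfl⟩, -, -⟩ := h.exists_sbtw
  obtain ⟨u, hu⟩ := mem_affineSpan_pair_iff_exists_lineMap_eq.1 hZ
  have hcoord (i : Fin 2) : u * (Y i - X i) + X i = t * (Q i - P i) + P i := by
    simpa [AffineMap.lineMap_apply] using congrArg (fun V : Plane => V i) hu
  have hPQ : (1 - t) * signedArea X Y P + t * signedArea X Y Q = 0 := by
    unfold signedArea
    linear_combination (Y 1 - X 1) * hcoord 0 - (Y 0 - X 0) * hcoord 1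
  have ht : t ≠ 0 := by
    rintro rfl
    have hP : P ∈ line[ℝ, X, Y] := by simpa using hZ
    exact h.left_notMem hP
  have hmem : (1 - t) * (signedArea X Y P * signedArea X Y Q) = -t * signedArea X Y Q ^ 2 := by
    linear_combination signedArea X Y Q * hPQ
  have htpos : 0 < t := lt_of_le_of_ne ht0 ht.symm
  have : 0 < t * signedArea X Y Q ^ 2 := by positivity
  nlinarith [sub_nonneg.2 ht1]

lemma dist_sq_of_barycentric {A B C P : Plane} (N : Plane) {α β γ : ℝ}
    (hsum : α + β + γ = 1) (hP : ∀ i, P i = α * A i + β * B i + γ * C i) :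
    dist N P ^ 2 = α * dist N A ^ 2 + β * dist N B ^ 2 + γ * dist N C ^ 2 -
      (β * γ * dist B C ^ 2 + γ * α * dist C A ^ 2 + α * β * dist A B ^ 2) := by
  obtain rfl : γ = 1 - α - β := by linarith
  simp only [dist_sq_eq_coords, hP]
  ring

lemma four_mul_signedArea_sq (A B C : Plane) :
    4 * signedArea A B C ^ 2 = 4 * dist C A ^ 2 * dist A B ^ 2 -
      (dist C A ^ 2 + dist A B ^ 2 - dist B C ^ 2) ^ 2 := by
  simp only [dist_sq_eq_coords, signedArea]
  ring

lemma signedArea_mul_coord (A B C P : Plane) (i : Fin 2) :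
    signedArea A B C * P i =
      signedArea B C P * A i + signedArea C A P * B i + signedArea A B P * C i := by
  fin_cases i <;> simp [signedArea] <;> ring

lemma signedArea_add (A B C P : Plane) :
    signedArea B C P + signedArea C A P + signedArea A B P = signedArea A B C := by
  unfold signedArea; ring

/-- The circumradius formula `4 * area * R = a * b * c` (squared) for a triangle with one vertex at
the origin, where `u` is the circumcenter. -/
lemma radius_eq_of_inscribed {u₀ u₁ g₀ g₁ h₀ h₁ : ℝ}
    (hg : g₀ ^ 2 + g₁ ^ 2 = 2 * (u₀ * g₀ + u₁ * g₁))
    (hh : h₀ ^ 2 + h₁ ^ 2 = 2 * (u₀ * h₀ + u₁ * h₁)) :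
    4 * (g₀ * h₁ - g₁ * h₀) ^ 2 * (u₀ ^ 2 + u₁ ^ 2) =
      (g₀ ^ 2 + g₁ ^ 2) * (h₀ ^ 2 + h₁ ^ 2) * ((g₀ - h₀) ^ 2 + (g₁ - h₁) ^ 2) := by
  have h0 : 2 * (g₀ * h₁ - g₁ * h₀) * u₀ =
      (g₀ ^ 2 + g₁ ^ 2) * h₁ - (h₀ ^ 2 + h₁ ^ 2) * g₁ := by
    linear_combination g₁ * hh - h₁ * hg
  have h1 : 2 * (g₀ * h₁ - g₁ * h₀) * u₁ =
      (h₀ ^ 2 + h₁ ^ 2) * g₀ - (g₀ ^ 2 + g₁ ^ 2) * h₀ := by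
    linear_combination h₀ * hg - g₀ * hh
  linear_combination
    (2 * (g₀ * h₁ - g₁ * h₀) * u₀ + ((g₀ ^ 2 + g₁ ^ 2) * h₁ - (h₀ ^ 2 + h₁ ^ 2) * g₁)) * h0 +
    (2 * (g₀ * h₁ - g₁ * h₀) * u₁ + ((h₀ ^ 2 + h₁ ^ 2) * g₀ - (g₀ ^ 2 + g₁ ^ 2) * h₀)) * h1

lemma abs_eq_of_signedArea_eq_mul {P X Y : Plane} {D r α : ℝ} (hD : D ≠ 0)
    (hr : Metric.infDist P (line[ℝ, X, Y] : Set Plane) = r) (hα : signedArea X Y P = D * α) :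
    |α| = r / |D| * dist X Y := by
  have := abs_pos.2 hD
  rw [div_mul_eq_mul_div, eq_div_iff this.ne', ← hr, infDist_line_mul_dist, hα, abs_mul, mul_comm]

lemma mul_sub_le_mul_of_triangle {a b c : ℝ} (ha : a ≤ b + c) (hb : b ≤ c + a) (hc : c ≤ a + b) :
    (b + c - a) * (c + a - b) * (a + b - c) ≤ a * b * c := by
  nlinarith [mul_nonneg (sub_nonneg.2 ha) (sq_nonneg (b - c)),
    mul_nonneg (sub_nonneg.2 hb) (sq_nonneg (c - a)),
    mul_nonneg (sub_nonneg.2 hc) (sq_nonneg (a - b))]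

/-- `N` and `ρ` are the center and radius of the nine-point circle of `ABC`. -/
structure IsNinePointCircle (A B C N : Plane) (ρ : ℝ) : Prop where
  dist_midpoint_AB : dist N (midpoint ℝ A B) = ρ
  dist_midpoint_BC : dist N (midpoint ℝ B C) = ρ
  dist_midpoint_CA : dist N (midpoint ℝ C A) = ρ

lemma midpoint_coord (X Y : Plane) (i : Fin 2) : midpoint ℝ X Y i = (X i + Y i) / 2 := by
  rw [midpoint_eq_smul_add, PiLp.smul_apply, PiLp.add_apply, smul_eq_mul, invOf_eq_inv]
  ring

namespace IsNinePointCircle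

variable {A B C N : Plane} {ρ : ℝ}

lemma rotate (h : IsNinePointCircle A B C N ρ) : IsNinePointCircle B C A N ρ :=
  ⟨h.2, h.3, h.1⟩

lemma radius_nonneg (h : IsNinePointCircle A B C N ρ) : 0 ≤ ρ :=
  h.dist_midpoint_AB ▸ dist_nonneg

lemma dist_vertex_sq (h : IsNinePointCircle A B C N ρ) :
    dist N A ^ 2 = ρ ^ 2 + (dist C A ^ 2 + dist A B ^ 2 - dist B C ^ 2) / 4 := by
  obtain ⟨h1, h2, h3⟩ := h
  replace h1 := congrArg (· ^ 2) h1
  replace h2 := congrArg (· ^ 2) h2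
  replace h3 := congrArg (· ^ 2) h3
  simp only [dist_sq_eq_coords, midpoint_coord] at h1 h2 h3 ⊢
  linear_combination h1 - h2 + h3

lemma radius_mul_signedArea_sq (h : IsNinePointCircle A B C N ρ) :
    (4 * ρ * signedArea A B C) ^ 2 = (dist B C * dist C A * dist A B) ^ 2 := by
  obtain ⟨h1, h2, h3⟩ := h
  replace h1 := congrArg (· ^ 2) h1
  replace h2 := congrArg (· ^ 2) h2
  replace h3 := congrArg (· ^ 2) h3
  simp only [dist_sq_eq_coords, midpoint_coord] at h1 h2 h3
  have hu := radius_eq_of_inscribed (u₀ := N 0 - (A 0 + B 0) / 2) (u₁ := N 1 - (A 1 + B 1) / 2)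
    (g₀ := (C 0 - A 0) / 2) (g₁ := (C 1 - A 1) / 2) (h₀ := (C 0 - B 0) / 2) (h₁ := (C 1 - B 1) / 2)
    (by linear_combination h2 - h1) (by linear_combination h3 - h1)
  rw [h1] at hu
  simp only [mul_pow, dist_sq_eq_coords, signedArea]
  linear_combination 64 * hu

/-- With signed side lengths `x`, `y`, `z`, the point with barycentric coordinates
`k * x`, `k * y`, `k * z` is the center of a circle tangent to the nine-point circle. -/
lemma dist_sq_of_signed_sides (h : IsNinePointCircle A B C N ρ)
    (hD : signedArea A B C ≠ 0) {P : Plane} {k x y z : ℝ}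
    (hx : x ^ 2 = dist B C ^ 2) (hy : y ^ 2 = dist C A ^ 2) (hz : z ^ 2 = dist A B ^ 2)
    (hPx : signedArea B C P = signedArea A B C * (k * x))
    (hPy : signedArea C A P = signedArea A B C * (k * y))
    (hPz : signedArea A B P = signedArea A B C * (k * z)) :
    (4 * signedArea A B C * dist N P) ^ 2 = (x * y * z - 4 * signedArea A B C ^ 2 * k) ^ 2 := by
  have hsum : k * x + k * y + k * z = 1 := by
    apply mul_left_cancel₀ hD
    linear_combination signedArea_add A B C P - hPx - hPy - hPz
  have hP (i : Fin 2) : P i = k * x * A i + k * y * B i + k * z * C i := by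
    apply mul_left_cancel₀ hD
    rw [signedArea_mul_coord, hPx, hPy, hPz]
    ring
  have hNP := dist_sq_of_barycentric N hsum hP
  have hheron := four_mul_signedArea_sq A B C
  have hR := h.radius_mul_signedArea_sq
  rw [h.dist_vertex_sq, h.rotate.dist_vertex_sq, h.rotate.rotate.dist_vertex_sq,
    ← hx, ← hy, ← hz] at hNP
  rw [mul_pow (_ * _) (dist A B), mul_pow (dist B C), ← hx, ← hy, ← hz] at hR
  rw [← hx, ← hy, ← hz] at hheron
  rw [mul_pow, hNP]
  linear_combination hR + (16 * signedArea A B C ^ 2 * (ρ ^ 2 - k * x * y * z) -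
    4 * signedArea A B C ^ 2 * k * ((y + z - x) * (z + x - y) * (x + y - z))) * hsum -
    4 * signedArea A B C ^ 2 * k ^ 2 * hheron

lemma radius_mul_abs_signedArea (h : IsNinePointCircle A B C N ρ) :
    4 * |signedArea A B C| * ρ = dist B C * dist C A * dist A B := by
  have h0 := h.radius_nonneg
  rw [← sq_eq_sq₀ (by positivity) (by positivity), ← h.radius_mul_signedArea_sq, mul_pow, mul_pow,
    sq_abs]
  ring

/-- With signed side lengths `x`, `y`, `z`, a point with barycentric coordinates proportional to
`x`, `y`, `z` is the center of a circle tangent to the nine-point circle. -/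
lemma dist_sq_of_tangent_circle (h : IsNinePointCircle A B C N ρ)
    (hD : signedArea A B C ≠ 0) {P : Plane} {r x y z : ℝ}
    (hx : x ^ 2 = dist B C ^ 2) (hy : y ^ 2 = dist C A ^ 2) (hz : z ^ 2 = dist A B ^ 2)
    (hPx : signedArea B C P = signedArea A B C * (r / |signedArea A B C| * x))
    (hPy : signedArea C A P = signedArea A B C * (r / |signedArea A B C| * y))
    (hPz : signedArea A B P = signedArea A B C * (r / |signedArea A B C| * z)) :
    (4 * |signedArea A B C| * dist N P) ^ 2 = (x * y * z - 4 * |signedArea A B C| * r) ^ 2 := by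
  have key := h.dist_sq_of_signed_sides hD hx hy hz hPx hPy hPz
  have hDr : signedArea A B C ^ 2 * (r / |signedArea A B C|) = |signedArea A B C| * r := by
    have := abs_pos.2 hD
    rw [← sq_abs]; field_simp
  rw [mul_assoc 4 (_ ^ 2), hDr, ← mul_assoc] at key
  rw [← key, mul_pow, mul_pow, sq_abs]
  ring

lemma dist_incenter (h : IsNinePointCircle A B C N ρ) (hD : signedArea A B C ≠ 0)
    {P : Plane} {r α β γ : ℝ} (hα : 0 < α) (hβ : 0 < β) (hγ : 0 < γ) (hsum : α + β + γ = 1)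
    (hP : P = α • A + β • B + γ • C)
    (h1 : Metric.infDist P (line[ℝ, B, C] : Set Plane) = r)
    (h2 : Metric.infDist P (line[ℝ, C, A] : Set Plane) = r)
    (h3 : Metric.infDist P (line[ℝ, A, B] : Set Plane) = r) :
    dist N P = ρ - r := by
  have hD' : 0 < |signedArea A B C| := abs_pos.2 hD
  have hcoord (i : Fin 2) : P i = α * A i + β * B i + γ * C i := by simp [hP]
  obtain rfl : γ = 1 - α - β := by linarith
  have hA : signedArea B C P = signedArea A B C * α := by
    simp only [signedArea, hcoord]; ring
  have hB : signedArea C A P = signedArea A B C * β := by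
    simp only [signedArea, hcoord]; ring
  have hC : signedArea A B P = signedArea A B C * (1 - α - β) := by
    simp only [signedArea, hcoord]; ring
  have eA := abs_eq_of_signedArea_eq_mul hD h1 hA
  have eB := abs_eq_of_signedArea_eq_mul hD h2 hB
  have eC := abs_eq_of_signedArea_eq_mul hD h3 hC
  rw [abs_of_pos hα] at eA
  rw [abs_of_pos hβ] at eB
  rw [abs_of_pos hγ] at eC
  have key := h.dist_sq_of_tangent_circle hD rfl rfl rfl
    (by rw [hA, eA]) (by rw [hB, eB]) (by rw [hC, eC])
  have hR := h.radius_mul_abs_signedArea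
  have hr : r * (dist B C + dist C A + dist A B) = |signedArea A B C| := by
    field_simp at eA eB eC
    linarith
  have hs : 0 < dist B C + dist C A + dist A B := by
    refine lt_of_le_of_ne (by positivity) fun h0 => hD'.ne ?_
    rw [← hr, ← h0, mul_zero]
  have hheron : 4 * |signedArea A B C| * r = (dist C A + dist A B - dist B C) *
      (dist A B + dist B C - dist C A) * (dist B C + dist C A - dist A B) := by
    apply mul_right_cancel₀ hs.ne'
    rw [mul_assoc, hr, mul_assoc, ← sq, sq_abs, four_mul_signedArea_sq]
    ring
  have heuler := mul_sub_le_mul_of_triangle (a := dist B C) (b := dist C A) (c := dist A B)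
    (by rw [dist_comm C A, add_comm]; exact dist_triangle_left B C A)
    (by rw [dist_comm A B, add_comm]; exact dist_triangle_left C A B)
    (by rw [dist_comm B C, add_comm]; exact dist_triangle_left A B C)
  rw [sq_eq_sq₀ (by positivity) (by rw [hheron]; linarith), ← hR, ← mul_sub] at key
  exact mul_left_cancel₀ (by positivity) key

lemma dist_excenter (h : IsNinePointCircle A B C N ρ) (hD : signedArea A B C ≠ 0)
    {P : Plane} {r : ℝ} (hP : (line[ℝ, B, C]).SOppSide P A)
    (h1 : Metric.infDist P (line[ℝ, B, C] : Set Plane) = r)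
    (h2 : Metric.infDist P (line[ℝ, C, A] : Set Plane) = r)
    (h3 : Metric.infDist P (line[ℝ, A, B] : Set Plane) = r) :
    dist N P = ρ + r := by
  have hD' : 0 < |signedArea A B C| := abs_pos.2 hD
  have hr : 0 ≤ r := h1 ▸ Metric.infDist_nonneg
  obtain ⟨α, hA⟩ : ∃ α, signedArea B C P = signedArea A B C * α := ⟨_, (mul_div_cancel₀ _ hD).symm⟩
  obtain ⟨β, hB⟩ : ∃ β, signedArea C A P = signedArea A B C * β := ⟨_, (mul_div_cancel₀ _ hD).symm⟩
  obtain ⟨γ, hC⟩ : ∃ γ, signedArea A B P = signedArea A B C * γ := ⟨_, (mul_div_cancel₀ _ hD).symm⟩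
  have hsum : α + β + γ = 1 := by
    apply mul_left_cancel₀ hD
    linear_combination signedArea_add A B C P - hA - hB - hC
  have hα : α < 0 := by
    have hopp := signedArea_mul_neg_of_sOppSide hP (by rwa [signedArea_rotate])
    rw [signedArea_rotate A B C, hA] at hopp
    have := sq_nonneg (signedArea A B C)
    by_contra! h0
    nlinarith [mul_nonneg this h0]
  have eA := abs_eq_of_signedArea_eq_mul hD h1 hA
  have eB := abs_eq_of_signedArea_eq_mul hD h2 hB
  have eC := abs_eq_of_signedArea_eq_mul hD h3 hC
  rw [abs_of_neg hα] at eA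
  have hk : 0 ≤ r / |signedArea A B C| := by positivity
  have hβ : β = r / |signedArea A B C| * dist C A := by
    rcases eq_or_eq_neg_of_abs_eq eB with hβ | hβ
    · exact hβ
    have := mul_le_mul_of_nonneg_left (dist_triangle_left A B C) hk
    rw [dist_comm C B] at this
    linarith [le_abs_self γ]
  have hγ : γ = r / |signedArea A B C| * dist A B := by
    rcases eq_or_eq_neg_of_abs_eq eC with hγ | hγ
    · exact hγ
    have := mul_le_mul_of_nonneg_left (dist_triangle_left C A B) hk
    rw [dist_comm B A] at this
    linarith
  have key := h.dist_sq_of_tangent_circle hD (x := -dist B C) (neg_sq _) rfl rfl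
    (by rw [hA, mul_neg, ← eA, neg_neg]) (by rw [hB, hβ]) (by rw [hC, hγ])
  have hρ := h.radius_nonneg
  have hR := h.radius_mul_abs_signedArea
  rw [neg_mul, neg_mul, ← hR, ← neg_add', neg_sq, ← mul_add,
    sq_eq_sq₀ (by positivity) (by positivity)] at key
  exact mul_left_cancel₀ (by positivity) key

end IsNinePointCircle

/-- **Feuerbach's theorem.** Let `N`, `ρ` be the circumcenter and circumradius of the medial
triangle of `A B C` (i.e. the center and radius of the nine-point circle), `I`, `r` the
incenter and inradius, and `IA, IB, IC`, `rA, rB, rC` the excenters and exradii.  Then the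
nine-point circle is internally tangent to the incircle and externally tangent to the three
excircles. -/
theorem feuerbach
    (A B C N I IA IB IC : EuclideanSpace ℝ (Fin 2)) (ρ r rA rB rC : ℝ)
    (hABC : AffineIndependent ℝ ![A, B, C])
    -- `N` and `ρ` are the circumcenter and circumradius of the medial triangle
    (hN1 : dist N (midpoint ℝ A B) = ρ)
    (hN2 : dist N (midpoint ℝ B C) = ρ)
    (hN3 : dist N (midpoint ℝ C A) = ρ)
    -- `I` is the incenter: an interior point equidistant from the three side lines,
    -- and `r` is the inradius, the common distance
    (hIint : ∃ α β γ : ℝ, 0 < α ∧ 0 < β ∧ 0 < γ ∧ α + β + γ = 1 ∧ I = α • A + β • B + γ • C)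
    (hI1 : Metric.infDist I (line[ℝ, B, C] : Set (EuclideanSpace ℝ (Fin 2))) = r)
    (hI2 : Metric.infDist I (line[ℝ, C, A] : Set (EuclideanSpace ℝ (Fin 2))) = r)
    (hI3 : Metric.infDist I (line[ℝ, A, B] : Set (EuclideanSpace ℝ (Fin 2))) = r)
    -- `IA` is the excenter opposite `A`, with exradius `rA`, etc.
    (hIA0 : (line[ℝ, B, C]).SOppSide IA A)
    (hIA1 : Metric.infDist IA (line[ℝ, B, C] : Set (EuclideanSpace ℝ (Fin 2))) = rA)
    (hIA2 : Metric.infDist IA (line[ℝ, C, A] : Set (EuclideanSpace ℝ (Fin 2))) = rA)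
    (hIA3 : Metric.infDist IA (line[ℝ, A, B] : Set (EuclideanSpace ℝ (Fin 2))) = rA)
    (hIB0 : (line[ℝ, C, A]).SOppSide IB B)
    (hIB1 : Metric.infDist IB (line[ℝ, B, C] : Set (EuclideanSpace ℝ (Fin 2))) = rB)
    (hIB2 : Metric.infDist IB (line[ℝ, C, A] : Set (EuclideanSpace ℝ (Fin 2))) = rB)
    (hIB3 : Metric.infDist IB (line[ℝ, A, B] : Set (EuclideanSpace ℝ (Fin 2))) = rB)
    (hIC0 : (line[ℝ, A, B]).SOppSide IC C)
    (hIC1 : Metric.infDist IC (line[ℝ, B, C] : Set (EuclideanSpace ℝ (Fin 2))) = rC)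
    (hIC2 : Metric.infDist IC (line[ℝ, C, A] : Set (EuclideanSpace ℝ (Fin 2))) = rC)
    (hIC3 : Metric.infDist IC (line[ℝ, A, B] : Set (EuclideanSpace ℝ (Fin 2))) = rC) :
    dist N I = ρ - r ∧ dist N IA = ρ + rA ∧ dist N IB = ρ + rB ∧ dist N IC = ρ + rC := by
  have hD := signedArea_ne_zero_of_affineIndependent hABC
  have hN : IsNinePointCircle A B C N ρ := ⟨hN1, hN2, hN3⟩
  have hDB : signedArea B C A ≠ 0 := by rwa [signedArea_rotate]
  have hDC : signedArea C A B ≠ 0 := by rwa [signedArea_rotate]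
  obtain ⟨α, β, γ, hα, hβ, hγ, hsum, hI⟩ := hIint
  exact ⟨hN.dist_incenter hD hα hβ hγ hsum hI hI1 hI2 hI3,
    hN.dist_excenter hD hIA0 hIA1 hIA2 hIA3,
    hN.rotate.dist_excenter hDB hIB0 hIB2 hIB3 hIB1,
    hN.rotate.rotate.dist_excenter hDC hIC0 hIC3 hIC1 hIC2⟩
end

section
/- Let a, b, c, d ∈ ℝ³ be in general position, and let e, f, g ∈ ℝ³ be nonzero vectors with e ∈ span{a, d} ∩ span{b, c}, f ∈ span{a, b} ∩ span{c, d}, g ∈ span{a, c} ∩ span{b, d} (the diagonal points). Then for every quadratic form Q on ℝ³ vanishing at a, b, c and d one has B_Q(e, f) = B_Q(f, g) = B_Q(e, g) = 0; that is, the diagonal triangle of a complete quadrangle is self-polar with respect to every conic circumscribed about the quadrangle: each of its vertices is the pole of the opposite side. -/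
/-- If `d = x a + y b + z c` with `a, b, c` linearly independent, then the intersection of
the planes `span {a, d}` and `span {b, c}` is the line spanned by `y b + z c`. -/
lemma exists_eq_smul_of_mem_span_pair_inter {K V : Type*} [Field K] [AddCommGroup V] [Module K V]
    {a b c d e : V} {x y z : K} (h : LinearIndependent K ![a, b, c])
    (hd : d = x • a + y • b + z • c)
    (he : e ∈ Submodule.span K {a, d}) (he' : e ∈ Submodule.span K {b, c}) :
    ∃ t : K, e = t • (y • b + z • c) := by
  obtain ⟨p, q, rfl⟩ := Submodule.mem_span_pair.1 he
  obtain ⟨r, s, hrs⟩ := Submodule.mem_span_pair.1 he'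
  have h0 : (p + q * x) • a + (q * y - r) • b + (q * z - s) • c = 0 := by
    have h1 : p • a + q • d - (r • b + s • c) = 0 := by rw [hrs, sub_self]
    rw [← h1, hd]
    module
  have hp : p + q * x = 0 := by
    have := Fintype.linearIndependent_iff.1 h ![p + q * x, q * y - r, q * z - s]
      (by simpa [Fin.sum_univ_three] using h0) 0
    simpa using this
  refine ⟨q, ?_⟩
  rw [hd, eq_neg_of_add_eq_zero_left hp]
  module

/-- If a quadratic form vanishes at `u`, `v`, `w` and at `u + v + w`, then `u + v` and `v + w`
are conjugate with respect to it. -/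
lemma QuadraticMap.polar_add_add_eq_zero {R M N : Type*} [CommRing R] [AddCommGroup M]
    [AddCommGroup N] [Module R M] [Module R N] (Q : QuadraticMap R M N) {u v w : M}
    (hu : Q u = 0) (hv : Q v = 0) (hw : Q w = 0) (h : Q (u + v + w) = 0) :
    QuadraticMap.polar Q (u + v) (v + w) = 0 := by
  have hs : QuadraticMap.polar Q (u + v) w + QuadraticMap.polar Q u v = 0 := by
    simp [QuadraticMap.polar, hu, hv, hw, h]
  rw [QuadraticMap.polar_add_right, QuadraticMap.polar_add_left Q u v v,
    QuadraticMap.polar_self, hv, smul_zero, add_zero, add_comm, hs]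

/-- **The diagonal triangle of a complete quadrangle is self-polar** with respect to every
conic circumscribed about the quadrangle: if `a, b, c, d ∈ ℝ³` are in general position with
diagonal points `e, f, g`, then for every quadratic form `Q` vanishing at `a, b, c, d` one has
`B_Q(e, f) = B_Q(f, g) = B_Q(e, g) = 0`, where `B_Q(x, y) = (Q(x+y) - Q(x) - Q(y))/2` is the
polar form of `Q`. -/
theorem diagonal_triangle_self_polar
    (a b c d e f g : Fin 3 → ℝ)
    (h1 : LinearIndependent ℝ ![a, b, c])
    (h2 : LinearIndependent ℝ ![a, b, d])
    (h3 : LinearIndependent ℝ ![a, c, d])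
    (h4 : LinearIndependent ℝ ![b, c, d])
    (he0 : e ≠ 0) (he1 : e ∈ Submodule.span ℝ {a, d}) (he2 : e ∈ Submodule.span ℝ {b, c})
    (hf0 : f ≠ 0) (hf1 : f ∈ Submodule.span ℝ {a, b}) (hf2 : f ∈ Submodule.span ℝ {c, d})
    (hg0 : g ≠ 0) (hg1 : g ∈ Submodule.span ℝ {a, c}) (hg2 : g ∈ Submodule.span ℝ {b, d}) :
    ∀ Q : QuadraticForm ℝ (Fin 3 → ℝ),
      Q a = 0 → Q b = 0 → Q c = 0 → Q d = 0 →
      (Q (e + f) - Q e - Q f) / 2 = 0 ∧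
      (Q (f + g) - Q f - Q g) / 2 = 0 ∧
      (Q (e + g) - Q e - Q g) / 2 = 0 := by
  intro Q ha hb hc hd
  obtain ⟨x, y, z, hxyz⟩ : ∃ x y z : ℝ, x • a + y • b + z • c = d := by
    have htop := h1.span_eq_top_of_card_eq_finrank' (by simp)
    have hmem : d ∈ Submodule.span ℝ (Set.range ![a, b, c]) := htop ▸ Submodule.mem_top
    obtain ⟨k, hk⟩ := (Submodule.mem_span_range_iff_exists_fun ℝ).1 hmem
    exact ⟨k 0, k 1, k 2, by simpa [Fin.sum_univ_three] using hk⟩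
  have hcab : LinearIndependent ℝ ![c, a, b] := by
    convert h1.comp ![2, 0, 1] (by decide) using 1
    ext i : 1
    fin_cases i <;> rfl
  have hbac : LinearIndependent ℝ ![b, a, c] := by
    convert h1.comp ![1, 0, 2] (by decide) using 1
    ext i : 1
    fin_cases i <;> rfl
  obtain ⟨r, rfl⟩ := exists_eq_smul_of_mem_span_pair_inter h1 hxyz.symm he1 he2
  obtain ⟨s, rfl⟩ := exists_eq_smul_of_mem_span_pair_inter (x := z) (y := x) (z := y) hcab
    (by rw [← hxyz]; abel) hf2 hf1
  obtain ⟨t, rfl⟩ := exists_eq_smul_of_mem_span_pair_inter (x := y) (y := x) (z := z) hbac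
    (by rw [← hxyz]; abel) hg2 hg1
  have hA : Q (x • a) = 0 := by simp [QuadraticMap.map_smul, ha]
  have hB : Q (y • b) = 0 := by simp [QuadraticMap.map_smul, hb]
  have hC : Q (z • c) = 0 := by simp [QuadraticMap.map_smul, hc]
  rw [← hxyz] at hd
  generalize x • a = u at *
  generalize y • b = v at *
  generalize z • c = w at *
  have hef : QuadraticMap.polar Q (v + w) (u + v) = 0 := by
    rw [QuadraticMap.polar_comm]
    exact Q.polar_add_add_eq_zero hA hB hC hd
  have hfg : QuadraticMap.polar Q (u + v) (u + w) = 0 := by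
    rw [add_comm u v]
    exact Q.polar_add_add_eq_zero hB hA hC (by rwa [add_comm v u])
  have heg : QuadraticMap.polar Q (v + w) (u + w) = 0 := by
    rw [add_comm u w]
    exact Q.polar_add_add_eq_zero hB hC hA (by rwa [add_comm, ← add_assoc])
  have scale (m n : ℝ) {p q : Fin 3 → ℝ} (h : QuadraticMap.polar Q p q = 0) :
      (Q (m • p + n • q) - Q (m • p) - Q (n • q)) / 2 = 0 := by
    change QuadraticMap.polar Q (m • p) (n • q) / 2 = 0
    simp [QuadraticMap.polar_smul_left, QuadraticMap.polar_smul_right, h]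
  exact ⟨scale r s hef, scale s t hfg, scale r t heg⟩
end
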